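/- For every ε > 0 there exists a constant C(ε) > 0 such that for every positive integer q and every primitive quadratic Dirichlet character χ modulo q, the value L(1, χ) is a positive real number satisfying L(1, χ) > C(ε) · q^{-ε}. -/

import Mathlib

section

open Complex Filter Topology MeasureTheory

lemma lower_bound_of_hasSum {c : ℕ → ℝ} {L M S δ : ℝ} (hδ : 0 < δ) (hδ' : δ ≤ 1 / 8)
    (hM : 1 ≤ M) (hS : HasSum (fun m ↦ c m * (1 + δ) ^ m) S) (hc₀ : 1 - L ≤ c 0)
    (hc : ∀ m, -L ≤ c m) (hcM : ∀ m, |c m| ≤ 4 * M * (2 / 3) ^ m) (hSL : S ≤ L / δ) :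
    δ / 2 * (43 * M) ^ (-(4 * δ)) ≤ L := by
  have hM0 : 0 < M := by linarith
  obtain ⟨N, hN, hN'⟩ : ∃ N : ℕ, 32 * M ≤ (4 / 3 : ℝ) ^ N ∧ (4 / 3 : ℝ) ^ N ≤ 43 * M := by
    obtain ⟨n, hn, hn'⟩ := exists_nat_pow_near (x := 32 * M) (y := (4 / 3 : ℝ))
      (by linarith) (by norm_num)
    refine ⟨n + 1, hn'.le, ?_⟩
    rw [pow_succ]
    linarith
  have htail : -(1 / 2) ≤ ∑' m, c (m + N) * (1 + δ) ^ (m + N) := by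
    have hgeom : HasSum (fun m : ℕ ↦ -(4 * M * (3 / 4 : ℝ) ^ N) * (3 / 4 : ℝ) ^ m)
        (-(4 * M * (3 / 4 : ℝ) ^ N) * (1 - 3 / 4)⁻¹) :=
      (hasSum_geometric_of_lt_one (by norm_num) (by norm_num)).mul_left _
    have hsum : Summable fun m ↦ c (m + N) * (1 + δ) ^ (m + N) :=
      (summable_nat_add_iff N).mpr hS.summable
    have hle := hgeom.summable.tsum_le_tsum (g := fun m ↦ c (m + N) * (1 + δ) ^ (m + N))
      (fun m ↦ ?_) hsum
    · rw [hgeom.tsum_eq] at hle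
      have h34 : (3 / 4 : ℝ) ^ N * (4 / 3 : ℝ) ^ N = 1 := by rw [← mul_pow]; norm_num
      have h34' : 0 < (3 / 4 : ℝ) ^ N := by positivity
      nlinarith
    · have h1 : -(4 * M * (2 / 3) ^ (m + N)) ≤ c (m + N) := (abs_le.mp (hcM _)).1
      have h2 : (2 / 3 : ℝ) ^ (m + N) * (1 + δ) ^ (m + N) ≤ (3 / 4) ^ (m + N) := by
        rw [← mul_pow]
        gcongr
        linarith
      have h3 : 0 < (1 + δ) ^ (m + N) := by positivity
      calc -(4 * M * (3 / 4 : ℝ) ^ N) * (3 / 4 : ℝ) ^ m = -(4 * M * (3 / 4) ^ (m + N)) := by ring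
        _ ≤ -(4 * M * ((2 / 3 : ℝ) ^ (m + N) * (1 + δ) ^ (m + N))) := by gcongr
        _ = -(4 * M * (2 / 3 : ℝ) ^ (m + N)) * (1 + δ) ^ (m + N) := by ring
        _ ≤ _ := by gcongr
  have hhead : 1 - L * (((1 + δ) ^ N - 1) / δ) ≤ ∑ m ∈ Finset.range N, c m * (1 + δ) ^ m := by
    have hN0 : N ≠ 0 := by
      rintro rfl
      norm_num at hN
      linarith
    obtain ⟨n, rfl⟩ := Nat.exists_eq_succ_of_ne_zero hN0
    have hgs : ((1 + δ) ^ (n + 1) - 1) / δ = ∑ m ∈ Finset.range (n + 1), (1 + δ) ^ m := by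
      rw [geom_sum_eq (by linarith)]
      simp
    rw [Nat.succ_eq_add_one, hgs, Finset.sum_range_succ', Finset.sum_range_succ', mul_add,
      Finset.mul_sum]
    have : ∑ m ∈ Finset.range n, (-(L * (1 + δ) ^ (m + 1)))
        ≤ ∑ m ∈ Finset.range n, c (m + 1) * (1 + δ) ^ (m + 1) := by
      refine Finset.sum_le_sum fun m _ ↦ ?_
      rw [← neg_mul]
      gcongr
      exact hc _
    rw [Finset.sum_neg_distrib] at this
    simp only [pow_zero, mul_one]
    linarith
  have hsplit := hS.summable.sum_add_tsum_nat_add N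
  rw [hS.tsum_eq] at hsplit
  have hkey : 1 / 2 ≤ L * ((1 + δ) ^ N / δ) := by
    have h1 : L * ((1 + δ) ^ N / δ) = L * (((1 + δ) ^ N - 1) / δ) + L / δ := by
      field_simp
      ring
    linarith
  have hpow : (1 + δ) ^ N ≤ (43 * M) ^ (4 * δ) := by
    have h1 : 1 + δ ≤ (4 / 3 : ℝ) ^ (4 * δ) := by
      have he : Real.exp 1 ≤ (4 / 3 : ℝ) ^ 4 := by
        have := Real.exp_one_lt_d9
        norm_num at *
        linarith
      calc 1 + δ ≤ Real.exp δ := by linarith [Real.add_one_le_exp δ]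
        _ = Real.exp 1 ^ δ := by rw [Real.exp_one_rpow]
        _ ≤ ((4 / 3 : ℝ) ^ 4) ^ δ := by gcongr
        _ = _ := by rw [Real.rpow_mul (by norm_num)]; norm_num
    calc (1 + δ) ^ N ≤ ((4 / 3 : ℝ) ^ (4 * δ)) ^ N := by gcongr
      _ = ((4 / 3 : ℝ) ^ N) ^ (4 * δ) := by
        rw [← Real.rpow_natCast, ← Real.rpow_natCast, ← Real.rpow_mul (by norm_num),
          ← Real.rpow_mul (by norm_num), mul_comm]
      _ ≤ _ := by gcongr
  have hu : 0 < (1 + δ) ^ N := by positivity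
  have hL : 0 < L := by
    by_contra! h
    have : L * ((1 + δ) ^ N / δ) ≤ 0 := mul_nonpos_of_nonpos_of_nonneg h (by positivity)
    linarith
  have hX : 0 < (43 * M) ^ (4 * δ) := by positivity
  rw [Real.rpow_neg (by positivity), ← div_eq_mul_inv, div_le_iff₀ hX]
  calc δ / 2 = δ * (1 / 2) := by ring
    _ ≤ δ * (L * ((1 + δ) ^ N / δ)) := by gcongr
    _ = L * (1 + δ) ^ N := by field_simp
    _ ≤ _ := by gcongr

open scoped ComplexOrder in
lemma residue_lower_bound {a : ℕ → ℂ} (ha : 0 ≤ a) (ha₁ : 1 ≤ a 1)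
    (habs : LSeries.abscissaOfAbsConv a ≤ 1) {G : ℂ → ℂ} (hG : Differentiable ℂ G)
    (hGa : ∀ s : ℂ, 1 < s.re → G s = (s - 1) * LSeries a s) {M : ℝ} (hM : 1 ≤ M)
    (hGM : ∀ s : ℂ, ‖s - 2‖ = 3 / 2 → ‖G s‖ ≤ M) {δ : ℝ} (hδ : 0 < δ) (hδ' : δ ≤ 1 / 8)
    (hGδ : 0 ≤ (G (1 - δ : ℝ)).re) :
    δ / 2 * (43 * M) ^ (-(4 * δ)) ≤ (G 1).re := by
  have habs2 : LSeries.abscissaOfAbsConv a < (2 : ℝ) :=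
    habs.trans_lt (by exact_mod_cast one_lt_two)
  set H : ℂ → ℂ := dslope G 1 with hH
  have hHd : Differentiable ℂ H := by
    rw [← differentiableOn_univ, hH, Complex.differentiableOn_dslope univ_mem]
    exact hG.differentiableOn
  have hHne (s : ℂ) (hs : s ≠ 1) : H s = (G s - G 1) / (s - 1) := by
    rw [hH, dslope_of_ne _ hs, slope_def_field]
  have hder (m : ℕ) : iteratedDeriv m H 2 =
      iteratedDeriv m (LSeries a) (2 : ℝ) - G 1 * ((-1) ^ m * m.factorial) := by
    have hev : H =ᶠ[𝓝 (2 : ℂ)] fun s ↦ LSeries a s - G 1 * (s - 1)⁻¹ := by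
      have : {s : ℂ | 1 < s.re} ∈ 𝓝 (2 : ℂ) :=
        (isOpen_lt continuous_const continuous_re).mem_nhds (by simp)
      filter_upwards [this] with s hs
      have hs1 : s ≠ 1 := by rintro rfl; simp at hs
      have hs1' : s - 1 ≠ 0 := sub_ne_zero.mpr hs1
      rw [hHne s hs1, hGa s hs]
      field_simp
    have h1 : ContDiffAt ℂ m (LSeries a) (2 : ℂ) := by
      refine AnalyticAt.contDiffAt (LSeries_analyticOnNhd a 2 ?_)
      simpa using habs2
    have h2 : ContDiffAt ℂ m (fun s : ℂ ↦ (s - 1)⁻¹) (2 : ℂ) := by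
      refine ContDiffAt.inv (by fun_prop) (by norm_num)
    have h3 : iteratedDeriv m (fun s : ℂ ↦ (s - 1)⁻¹) (2 : ℂ) = (-1) ^ m * m.factorial := by
      have := iteratedDeriv_comp_sub_const m (fun s : ℂ ↦ s⁻¹) 1
      rw [this]
      simp only
      rw [iteratedDeriv_eq_iterate, iter_deriv_inv]
      norm_num
    rw [(hev.iteratedDeriv_eq m), iteratedDeriv_fun_sub h1 (contDiffAt_const.mul h2),
      iteratedDeriv_const_mul_field, h3]
    norm_num
  set b : ℕ → ℂ := fun m ↦ (m.factorial : ℂ)⁻¹ * ((-1) ^ m * iteratedDeriv m (LSeries a) (2 : ℝ))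
    with hb
  have hb0 (m : ℕ) : 0 ≤ b m := by
    refine mul_nonneg ?_ (LSeries.iteratedDeriv_alternating ha habs2 m)
    rw [inv_nonneg]
    exact Nat.cast_nonneg _
  have hb1 : 1 ≤ b 0 := by
    simp only [hb, Nat.factorial_zero, Nat.cast_one, inv_one, one_mul, pow_zero,
      iteratedDeriv_zero]
    have hsum : LSeriesSummable a (2 : ℝ) :=
      LSeriesSummable_of_abscissaOfAbsConv_lt_re (by simpa using habs2)
    have := hsum.le_tsum 1 (fun n _ ↦ LSeries.term_nonneg (ha n) 2)
    rw [LSeries.term_of_ne_zero one_ne_zero] at this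
    simp only [Nat.cast_one, one_cpow, div_one] at this
    exact ha₁.trans this
  have hHM (s : ℂ) (hs : s ∈ Metric.sphere (2 : ℂ) (3 / 2)) : ‖H s‖ ≤ 4 * M := by
    rw [mem_sphere_iff_norm] at hs
    have hs1 : 1 / 2 ≤ ‖s - 1‖ := by
      have := norm_sub_norm_le (s - 2) (-1)
      rw [hs, show s - 2 - -1 = s - 1 by ring] at this
      norm_num at this
      exact this
    have hs1' : s ≠ 1 := by rintro rfl; norm_num at hs1
    have hG1 : ‖G 1‖ ≤ M := by
      refine Complex.norm_le_of_forall_mem_frontier_norm_le (U := Metric.ball (2 : ℂ) (3 / 2))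
        Metric.isBounded_ball hG.diffContOnCl (fun z hz ↦ hGM z ?_) (subset_closure ?_)
      · rwa [frontier_ball _ (by norm_num), mem_sphere_iff_norm] at hz
      · rw [mem_ball_iff_norm]; norm_num
    rw [hHne s hs1', norm_div, div_le_iff₀ (by linarith)]
    calc ‖G s - G 1‖ ≤ ‖G s‖ + ‖G 1‖ := norm_sub_le _ _
      _ ≤ M + M := add_le_add (hGM s hs) hG1
      _ ≤ _ := by nlinarith
  have hcoef (m : ℕ) : (m.factorial : ℂ)⁻¹ * iteratedDeriv m H 2 * (-1) ^ m = b m - G 1 := by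
    have hm : (m.factorial : ℂ) ≠ 0 := by exact_mod_cast m.factorial_ne_zero
    have hsq : ((-1 : ℂ) ^ m) * (-1) ^ m = 1 := by rw [← mul_pow]; norm_num
    rw [hder, hb]
    simp only
    field_simp
    linear_combination (-(G 1 * m.factorial)) * hsq
  have hnorm (m : ℕ) : ‖b m - G 1‖ ≤ 4 * M * (2 / 3) ^ m := by
    have h := Complex.norm_iteratedDeriv_le_of_forall_mem_sphere_norm_le m
      (by norm_num : (0 : ℝ) < 3 / 2) hHd.diffContOnCl hHM
    have hm : (0 : ℝ) < m.factorial := by exact_mod_cast m.factorial_pos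
    rw [← hcoef]
    simp only [norm_mul, norm_inv, norm_pow, norm_neg, norm_one, one_pow, mul_one,
      RCLike.norm_natCast]
    rw [inv_mul_le_iff₀ hm]
    refine h.trans (le_of_eq ?_)
    rw [show (2 / 3 : ℝ) = (3 / 2)⁻¹ by norm_num, inv_pow]
    ring
  have hsum : HasSum (fun m ↦ (b m - G 1).re * (1 + δ) ^ m) (H (1 - δ : ℝ)).re := by
    have h := Complex.hasSum_re (hasSum_taylorSeries_of_entire hHd 2 (1 - δ : ℝ))
    convert! h using 2 with m
    rw [← hcoef, smul_eq_mul, smul_eq_mul,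
      show ((1 - δ : ℝ) : ℂ) - 2 = (-1) * (1 + δ : ℝ) by push_cast; ring, mul_pow, ← ofReal_pow,
      ← re_mul_ofReal]
    ring_nf
  refine lower_bound_of_hasSum hδ hδ' hM hsum ?_ (fun m ↦ ?_)
    (fun m ↦ (Complex.abs_re_le_norm _).trans (hnorm m)) ?_
  · have := (Complex.le_def.mp hb1).1
    simp at this ⊢
    linarith
  · have := (Complex.le_def.mp (hb0 m)).1
    simp at this ⊢
    linarith
  · rw [hHne _ (by simpa using hδ.ne')]
    have : ((1 - δ : ℝ) : ℂ) - 1 = (-δ : ℝ) := by push_cast; ring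
    rw [this, div_ofReal_re, sub_re, div_neg, ← neg_div]
    gcongr
    linarith

namespace DirichletCharacter
variable {q : ℕ} [NeZero q]

lemma sum_range_level {χ : DirichletCharacter ℂ q} (hχ : χ ≠ 1) :
    ∑ k ∈ Finset.range q, χ k = 0 := by
  rw [← MulChar.sum_eq_zero_of_ne_one hχ]
  refine Finset.sum_bij' (fun k _ ↦ (k : ZMod q)) (fun a _ ↦ a.val) (by simp)
    (fun a _ ↦ by simpa using a.val_lt) (fun k hk ↦ ?_) (by simp) (by simp)
  exact ZMod.val_cast_of_lt (by simpa using hk)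

lemma norm_sum_range_le {χ : DirichletCharacter ℂ q} (hχ : χ ≠ 1) (n : ℕ) :
    ‖∑ k ∈ Finset.range n, χ k‖ ≤ q := by
  induction n using Nat.strong_induction_on with
  | _ n ih =>
    rcases le_or_gt n q with h | h
    · calc ‖∑ k ∈ Finset.range n, χ k‖ ≤ ∑ k ∈ Finset.range n, (1 : ℝ) :=
            norm_sum_le_of_le _ fun k _ ↦ χ.norm_le_one _
        _ ≤ q := by simpa using h
    · obtain ⟨m, rfl⟩ := Nat.exists_eq_add_of_lt h
      rw [add_assoc, Finset.sum_range_add, sum_range_level hχ, zero_add]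
      simpa using ih (m + 1) (by have := NeZero.pos q; omega)

lemma norm_sum_Icc_le_level {χ : DirichletCharacter ℂ q} (hχ : χ ≠ 1) (n : ℕ) :
    ‖∑ k ∈ Finset.Icc 1 n, χ k‖ ≤ q := by
  have hq : q ≠ 1 := fun h ↦ hχ (level_one' _ h)
  have h0 : ∑ k ∈ Finset.Icc 1 n, χ k = ∑ k ∈ Finset.range (n + 1), χ k := by
    rw [Finset.range_eq_Ico, Finset.sum_eq_sum_Ico_succ_bot n.succ_pos, Nat.cast_zero,
      χ.map_zero' hq, zero_add]
    rfl
  rw [h0]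
  exact norm_sum_range_le hχ _

lemma norm_sum_Icc_floor_le {χ : DirichletCharacter ℂ q} (hχ : χ ≠ 1) {θ : ℝ} (hθ : 0 ≤ θ)
    (hθ' : θ ≤ 1) {t : ℝ} (ht : 0 ≤ t) :
    ‖∑ k ∈ Finset.Icc 1 ⌊t⌋₊, χ k‖ ≤ (q : ℝ) ^ θ * t ^ (1 - θ) := by
  have h1 := norm_sum_Icc_le_level hχ ⌊t⌋₊
  have h2 : ‖∑ k ∈ Finset.Icc 1 ⌊t⌋₊, χ k‖ ≤ t := by
    calc ‖∑ k ∈ Finset.Icc 1 ⌊t⌋₊, χ k‖ ≤ ∑ k ∈ Finset.Icc 1 ⌊t⌋₊, (1 : ℝ) :=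
            norm_sum_le_of_le _ fun k _ ↦ χ.norm_le_one _
      _ ≤ t := by simpa using Nat.floor_le ht
  set x := ‖∑ k ∈ Finset.Icc 1 ⌊t⌋₊, χ k‖
  have hx : 0 ≤ x := norm_nonneg _
  calc x = x ^ (θ + (1 - θ)) := by simp
    _ = x ^ θ * x ^ (1 - θ) := Real.rpow_add' hx (by simp)
    _ ≤ _ := by gcongr

lemma differentiableAt_mellin_sum_Icc_floor {χ : DirichletCharacter ℂ q} (hχ : χ ≠ 1) {s : ℂ}
    (hs : s.re < 0) :
    DifferentiableAt ℂ (mellin fun t : ℝ ↦ ∑ k ∈ Finset.Icc 1 ⌊t⌋₊, χ k) s := by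
  refine mellin_differentiableAt_of_isBigO_rpow (a := 0) (b := s.re - 1) ?_ ?_ hs ?_ (by linarith)
  · refine LocallyIntegrable.locallyIntegrableOn ?_ _
    have h : LocallyIntegrable (fun _ : ℝ ↦ (q : ℝ)) volume := locallyIntegrable_const _
    refine h.mono ?_ ?_
    · have hm : Measurable fun t : ℝ ↦ ∑ k ∈ Finset.Icc 1 ⌊t⌋₊, χ k :=
        (measurable_from_nat (f := fun n ↦ ∑ k ∈ Finset.Icc 1 n, χ k)).comp Nat.measurable_floor
      exact hm.aestronglyMeasurable
    · filter_upwards with t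
      simpa using norm_sum_Icc_le_level hχ ⌊t⌋₊
  · refine Asymptotics.isBigO_of_le' (c := q) _ fun t ↦ ?_
    simpa using norm_sum_Icc_le_level hχ ⌊t⌋₊
  · have h : (fun t : ℝ ↦ ∑ k ∈ Finset.Icc 1 ⌊t⌋₊, χ k) =ᶠ[𝓝[>] 0] fun _ ↦ 0 := by
      filter_upwards [Ioo_mem_nhdsGT zero_lt_one] with t ht
      simp [Nat.floor_eq_zero.mpr ht.2]
    exact h.trans_isBigO (Asymptotics.isBigO_zero _ _)

lemma LFunction_eq_mul_integral {χ : DirichletCharacter ℂ q} (hχ : χ ≠ 1) {s : ℂ}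
    (hs : 0 < s.re) :
    χ.LFunction s =
      s * ∫ t in Set.Ioi (1 : ℝ), (∑ k ∈ Finset.Icc 1 ⌊t⌋₊, χ k) * (t : ℂ) ^ (-(s + 1)) := by
  have hmellin (z : ℂ) : mellin (fun t : ℝ ↦ ∑ k ∈ Finset.Icc 1 ⌊t⌋₊, χ k) (-z) =
      ∫ t in Set.Ioi (1 : ℝ), (∑ k ∈ Finset.Icc 1 ⌊t⌋₊, χ k) * (t : ℂ) ^ (-(z + 1)) := by
    rw [← integral_Ici_eq_integral_Ioi, mellin]
    rw [setIntegral_eq_of_subset_of_forall_sdiff_eq_zero (s := Set.Ici (1 : ℝ)) measurableSet_Ioi]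
    · refine setIntegral_congr_fun measurableSet_Ici fun t _ ↦ ?_
      simp only [smul_eq_mul, mul_comm, neg_add']
    · exact fun t (ht : 1 ≤ t) ↦ zero_lt_one.trans_le ht
    · rintro t ⟨-, ht⟩
      have : ⌊t⌋₊ = 0 := Nat.floor_eq_zero.mpr (by simpa using ht)
      simp [this]
  have hU : IsOpen {z : ℂ | 0 < z.re} := isOpen_lt continuous_const continuous_re
  have hf : AnalyticOnNhd ℂ χ.LFunction {z : ℂ | 0 < z.re} :=
    (differentiable_LFunction hχ).differentiableOn.analyticOnNhd hU
  have hg : AnalyticOnNhd ℂ (fun z ↦ z * mellin (fun t : ℝ ↦ ∑ k ∈ Finset.Icc 1 ⌊t⌋₊, χ k) (-z))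
      {z : ℂ | 0 < z.re} := by
    refine DifferentiableOn.analyticOnNhd (fun z hz ↦ ?_) hU
    refine (differentiableAt_id.mul ?_).differentiableWithinAt
    have h := differentiableAt_mellin_sum_Icc_floor hχ (s := -z) (by simpa using hz)
    exact DifferentiableAt.fun_comp' z h differentiableAt_id.neg
  have heq : χ.LFunction =ᶠ[𝓝 2]
      fun z ↦ z * mellin (fun t : ℝ ↦ ∑ k ∈ Finset.Icc 1 ⌊t⌋₊, χ k) (-z) := by
    have : {z : ℂ | 1 < z.re} ∈ 𝓝 (2 : ℂ) :=
      (isOpen_lt continuous_const continuous_re).mem_nhds (by simp)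
    filter_upwards [this] with z hz
    rw [hmellin, LFunction_eq_LSeries _ hz]
    refine LSeries_eq_mul_integral _ le_rfl (zero_lt_one.trans hz)
      (LSeriesSummable_of_one_lt_re _ hz) ?_
    refine Asymptotics.isBigO_of_le' (c := q) _ fun t ↦ ?_
    simpa using norm_sum_Icc_le_level hχ t
  have hpre : IsPreconnected {z : ℂ | 0 < z.re} := (convex_halfSpace_re_gt 0).isPreconnected
  rw [← hmellin]
  exact hf.eqOn_of_preconnected_of_eventuallyEq hg hpre (by simp) heq hs

lemma norm_LFunction_le {χ : DirichletCharacter ℂ q} (hχ : χ ≠ 1) {θ : ℝ} (hθ : 0 ≤ θ)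
    (hθ' : θ ≤ 1) {s : ℂ} (hs : 1 - θ < s.re) :
    ‖χ.LFunction s‖ ≤ ‖s‖ * (q : ℝ) ^ θ / (s.re - (1 - θ)) := by
  rw [LFunction_eq_mul_integral hχ (by linarith), norm_mul, mul_div_assoc]
  gcongr
  have hexp : -θ - s.re < -1 := by linarith
  have hint := (integrableOn_Ioi_rpow_of_lt hexp zero_lt_one).const_mul ((q : ℝ) ^ θ)
  refine (norm_integral_le_of_norm_le hint ?_).trans (le_of_eq ?_)
  · filter_upwards [ae_restrict_mem measurableSet_Ioi] with t ht
    have ht0 : 0 < t := zero_lt_one.trans ht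
    rw [norm_mul, norm_cpow_eq_rpow_re_of_pos ht0]
    calc _ ≤ (q : ℝ) ^ θ * t ^ (1 - θ) * t ^ (-(s + 1)).re := by
          gcongr
          exact norm_sum_Icc_floor_le hχ hθ hθ' ht0.le
      _ = _ := by
          rw [mul_assoc, ← Real.rpow_add ht0]
          simp only [neg_re, add_re, one_re]
          ring_nf
  · rw [integral_const_mul, integral_Ioi_rpow_of_lt hexp zero_lt_one, Real.one_rpow,
      mul_div_assoc', mul_neg, mul_one, show s.re - (1 - θ) = -(-θ - s.re + 1) by ring, div_neg,
      neg_div]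

end DirichletCharacter

namespace DirichletCharacter
variable {q₁ q₂ q₃ : ℕ}

/-- The Dirichlet coefficients of `ζ(s) L(s, χ₁) L(s, χ₂) L(s, ψ)`. -/
noncomputable def biquadraticMul (χ₁ : DirichletCharacter ℂ q₁) (χ₂ : DirichletCharacter ℂ q₂)
    (ψ : DirichletCharacter ℂ q₃) : ArithmeticFunction ℂ :=
  zetaMul χ₁ * (toArithmeticFunction (χ₂ ·) * toArithmeticFunction (ψ ·))

lemma isMultiplicative_biquadraticMul (χ₁ : DirichletCharacter ℂ q₁)
    (χ₂ : DirichletCharacter ℂ q₂) (ψ : DirichletCharacter ℂ q₃) :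
    (biquadraticMul χ₁ χ₂ ψ).IsMultiplicative :=
  χ₁.isMultiplicative_zetaMul.mul <|
    (isMultiplicative_toArithmeticFunction χ₂).mul (isMultiplicative_toArithmeticFunction ψ)

lemma biquadraticMul_comm (χ₁ : DirichletCharacter ℂ q₁) (χ₂ : DirichletCharacter ℂ q₂)
    (ψ : DirichletCharacter ℂ q₃) : biquadraticMul χ₁ χ₂ ψ = biquadraticMul χ₂ χ₁ ψ := by
  simp only [biquadraticMul, zetaMul]
  ring

lemma toArithmeticFunction_mul_apply {χ₁ : DirichletCharacter ℂ q₁}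
    {χ₂ : DirichletCharacter ℂ q₂} {ψ : DirichletCharacter ℂ q₃}
    (hψ : ∀ n : ℕ, ψ n = χ₁ n * χ₂ n) {n : ℕ} (hn : n ≠ 0) :
    (toArithmeticFunction (χ₂ ·) * toArithmeticFunction (ψ ·)) n = χ₂ n * zetaMul χ₁ n := by
  rw [zetaMul, ArithmeticFunction.mul_apply, ArithmeticFunction.mul_apply, Finset.mul_sum]
  refine Finset.sum_congr rfl fun x hx ↦ ?_
  obtain ⟨hx, -⟩ := Nat.mem_divisorsAntidiagonal.mp hx
  obtain ⟨h1, h2⟩ : x.1 ≠ 0 ∧ x.2 ≠ 0 := by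
    rw [← mul_ne_zero_iff, hx]
    exact hn
  rw [← hx]
  simp only [toArithmeticFunction, ArithmeticFunction.coe_mk, h1, h2, if_false, hψ,
    ArithmeticFunction.natCoe_apply, ArithmeticFunction.zeta_apply, Nat.cast_mul, Nat.cast_one,
    map_mul]
  ring

open scoped ComplexOrder

lemma zetaMul_prime_pow_of_eq_neg_one {χ : DirichletCharacter ℂ q₁} {p : ℕ} (hp : p.Prime)
    (h : χ p = -1) (k : ℕ) : zetaMul χ (p ^ k) = if _root_.Even k then 1 else 0 := by
  have h1 : zetaMul χ (p ^ k) = ∑ i ∈ Finset.range (k + 1), (-1 : ℂ) ^ i := by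
    rw [zetaMul, ArithmeticFunction.coe_zeta_mul_apply, Nat.sum_divisors_prime_pow hp]
    refine Finset.sum_congr rfl fun i _ ↦ ?_
    rw [← χ.apply_eq_toArithmeticFunction_apply (pow_ne_zero i hp.ne_zero), Nat.cast_pow, map_pow,
      h]
  rw [h1, neg_one_geom_sum]
  simp only [Nat.even_add_one, ite_not]

variable {χ₁ : DirichletCharacter ℂ q₁} {χ₂ : DirichletCharacter ℂ q₂}
  {ψ : DirichletCharacter ℂ q₃}

lemma biquadraticMul_prime_pow_nonneg_of (hχ₁ : χ₁ ^ 2 = 1) (hψ : ∀ n : ℕ, ψ n = χ₁ n * χ₂ n)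
    {p : ℕ} (hp : p.Prime) (h : 0 ≤ χ₂ p ∨ χ₁ p = -1 ∧ χ₂ p = -1) (k : ℕ) :
    0 ≤ biquadraticMul χ₁ χ₂ ψ (p ^ k) := by
  rw [biquadraticMul, ArithmeticFunction.mul_apply]
  refine Finset.sum_nonneg fun x hx ↦ mul_nonneg (zetaMul_nonneg hχ₁ _) ?_
  obtain ⟨j, -, hj⟩ := (Nat.dvd_prime_pow hp).mp
    (Dvd.intro_left _ (Nat.mem_divisorsAntidiagonal.mp hx).1)
  rw [hj, toArithmeticFunction_mul_apply hψ (pow_ne_zero _ hp.ne_zero), Nat.cast_pow, map_pow]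
  rcases h with h | ⟨h₁, h₂⟩
  · exact mul_nonneg (pow_nonneg h _) (zetaMul_nonneg hχ₁ _)
  · rw [zetaMul_prime_pow_of_eq_neg_one hp h₁, h₂]
    split_ifs with he <;> simp [*]

lemma biquadraticMul_nonneg (hχ₁ : χ₁ ^ 2 = 1) (hχ₂ : χ₂ ^ 2 = 1)
    (hψ : ∀ n : ℕ, ψ n = χ₁ n * χ₂ n) (n : ℕ) : 0 ≤ biquadraticMul χ₁ χ₂ ψ n := by
  rcases eq_or_ne n 0 with rfl | hn
  · simp
  rw [(isMultiplicative_biquadraticMul χ₁ χ₂ ψ).multiplicative_factorization _ hn]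
  refine Finset.prod_nonneg fun p hp ↦ ?_
  have hp' := Nat.prime_of_mem_primeFactors hp
  have hswap : ∀ n : ℕ, ψ n = χ₂ n * χ₁ n := fun n ↦ by rw [hψ, mul_comm]
  rcases MulChar.isQuadratic_iff_sq_eq_one.mpr hχ₂ p with h₂ | h₂ | h₂
  · exact biquadraticMul_prime_pow_nonneg_of hχ₁ hψ hp' (.inl h₂.ge) _
  · exact biquadraticMul_prime_pow_nonneg_of hχ₁ hψ hp' (.inl (h₂ ▸ zero_le_one)) _
  · rcases MulChar.isQuadratic_iff_sq_eq_one.mpr hχ₁ p with h₁ | h₁ | h₁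
    · rw [biquadraticMul_comm]
      exact biquadraticMul_prime_pow_nonneg_of hχ₂ hswap hp' (.inl h₁.ge) _
    · rw [biquadraticMul_comm]
      exact biquadraticMul_prime_pow_nonneg_of hχ₂ hswap hp' (.inl (h₁ ▸ zero_le_one)) _
    · exact biquadraticMul_prime_pow_nonneg_of hχ₁ hψ hp' (.inr ⟨h₁, h₂⟩) _

section LSeries

variable {s : ℂ}

lemma LSeriesSummable_toArithmeticFunction (χ : DirichletCharacter ℂ q₁) (hs : 1 < s.re) :
    LSeriesSummable (toArithmeticFunction (χ ·)) s :=
  (LSeriesSummable_congr _ fun h ↦ (χ.apply_eq_toArithmeticFunction_apply h).symm).mpr <|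
    χ.LSeriesSummable_of_one_lt_re hs

lemma LSeries_toArithmeticFunction [NeZero q₁] (χ : DirichletCharacter ℂ q₁) (hs : 1 < s.re) :
    LSeries (toArithmeticFunction (χ ·)) s = χ.LFunction s := by
  rw [χ.LFunction_eq_LSeries hs]
  exact (LSeries_congr χ.apply_eq_toArithmeticFunction_apply s).symm

lemma LSeries_zetaMul [NeZero q₁] (χ : DirichletCharacter ℂ q₁) (hs : 1 < s.re) :
    LSeries χ.zetaMul s = riemannZeta s * χ.LFunction s := by
  have hζ : ⇑(ArithmeticFunction.zeta : ArithmeticFunction ℂ) =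
      fun n ↦ (ArithmeticFunction.zeta n : ℂ) := by
    ext n
    rw [ArithmeticFunction.natCoe_apply]
  have hζs : LSeriesSummable (ArithmeticFunction.zeta : ArithmeticFunction ℂ) s := by
    rw [hζ]
    exact ArithmeticFunction.LSeriesSummable_zeta_iff.mpr hs
  rw [zetaMul, ArithmeticFunction.LSeries_mul' hζs (χ.LSeriesSummable_toArithmeticFunction hs),
    χ.LSeries_toArithmeticFunction hs, hζ, ArithmeticFunction.LSeries_zeta_eq_riemannZeta hs]

variable (χ₁ χ₂ ψ) in
lemma LSeriesSummable_biquadraticMul (hs : 1 < s.re) :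
    LSeriesSummable (biquadraticMul χ₁ χ₂ ψ) s :=
  ArithmeticFunction.LSeriesSummable_mul (χ₁.LSeriesSummable_zetaMul hs) <|
    ArithmeticFunction.LSeriesSummable_mul (χ₂.LSeriesSummable_toArithmeticFunction hs)
      (ψ.LSeriesSummable_toArithmeticFunction hs)

variable (χ₁ χ₂ ψ) in
lemma LSeries_biquadraticMul [NeZero q₁] [NeZero q₂] [NeZero q₃] (hs : 1 < s.re) :
    LSeries (biquadraticMul χ₁ χ₂ ψ) s =
      riemannZeta s * χ₁.LFunction s * (χ₂.LFunction s * ψ.LFunction s) := by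
  have h₂ := χ₂.LSeriesSummable_toArithmeticFunction hs
  have h₃ := ψ.LSeriesSummable_toArithmeticFunction hs
  rw [biquadraticMul, ArithmeticFunction.LSeries_mul' (χ₁.LSeriesSummable_zetaMul hs)
    (ArithmeticFunction.LSeriesSummable_mul h₂ h₃), ArithmeticFunction.LSeries_mul' h₂ h₃,
    LSeries_zetaMul _ hs, LSeries_toArithmeticFunction _ hs, LSeries_toArithmeticFunction _ hs]

end LSeries

/-! ### The product character -/

lemma exists_mul_character {q₁ q₂ : ℕ} [NeZero q₁] [NeZero q₂] {χ₁ : DirichletCharacter ℂ q₁}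
    {χ₂ : DirichletCharacter ℂ q₂} (hχ₁ : χ₁ ^ 2 = 1) (hp₁ : χ₁.IsPrimitive)
    (hp₂ : χ₂.IsPrimitive) (hq : q₁ ≠ q₂) :
    ∃ ψ : DirichletCharacter ℂ (q₁ * q₂), ψ ≠ 1 ∧ ∀ n : ℕ, ψ n = χ₁ n * χ₂ n := by
  set φ₁ := changeLevel (dvd_mul_right q₁ q₂) χ₁ with hφ₁
  set φ₂ := changeLevel (dvd_mul_left q₂ q₁) χ₂ with hφ₂
  refine ⟨φ₁ * φ₂, fun h ↦ hq ?_, fun n ↦ ?_⟩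
  · have hsq : φ₁ * φ₁ = 1 := by rw [← sq, hφ₁, ← map_pow, hχ₁, map_one]
    have heq : φ₁ = φ₂ := mul_left_cancel (hsq.trans h.symm)
    have hc := congrArg conductor heq
    rwa [hφ₁, hφ₂, conductor_changeLevel, conductor_changeLevel, hp₁, hp₂] at hc
  · by_cases hn : n.Coprime (q₁ * q₂)
    · have hn' : IsCoprime (n : ℤ) ((q₁ * q₂ : ℕ) : ℤ) := Nat.isCoprime_iff_coprime.mpr hn
      have h1 := changeLevel_eq_cast_of_dvd' χ₁ (dvd_mul_right q₁ q₂) hn'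
      have h2 := changeLevel_eq_cast_of_dvd' χ₂ (dvd_mul_left q₂ q₁) hn'
      simp only [Int.cast_natCast] at h1 h2
      rw [MulChar.mul_apply, hφ₁, hφ₂, h1, h2]
    · rw [MulChar.map_nonunit _ (by rwa [ZMod.isUnit_iff_coprime])]
      rw [Nat.coprime_mul_iff_right, not_and_or] at hn
      rcases hn with hn | hn
      · rw [χ₁.map_nonunit (by rwa [ZMod.isUnit_iff_coprime]), zero_mul]
      · rw [χ₂.map_nonunit (by rwa [ZMod.isUnit_iff_coprime]), mul_zero]

end DirichletCharacter

section Siegel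

open scoped ComplexOrder

/-- The entire function `(s - 1) ζ(s)`. -/
local notation "ζ₁" => DirichletCharacter.LFunctionTrivChar₁ 1

lemma LFunctionTrivChar₁_one_apply_one : ζ₁ 1 = 1 := by simp

lemma LFunctionTrivChar₁_one_apply_of_ne_one {s : ℂ} (hs : s ≠ 1) :
    ζ₁ s = (s - 1) * riemannZeta s := by
  rw [DirichletCharacter.LFunctionTrivChar₁, Function.update_of_ne hs,
    DirichletCharacter.LFunctionTrivChar, DirichletCharacter.LFunction_modOne_eq]

lemma LFunctionTrivChar₁_one_ofReal_im (x : ℝ) : (ζ₁ x).im = 0 := by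
  rw [← conj_eq_iff_im]
  rcases eq_or_ne (x : ℂ) 1 with h | h
  · rw [h, LFunctionTrivChar₁_one_apply_one, map_one]
  · rw [LFunctionTrivChar₁_one_apply_of_ne_one h, map_mul, ← riemannZeta_conj, map_sub, map_one,
      conj_ofReal]

lemma residue_nonneg {a : ℕ → ℂ} (ha : 0 ≤ a) {G : ℂ → ℂ} (hG : Continuous G)
    (hGa : ∀ s : ℂ, 1 < s.re → G s = (s - 1) * LSeries a s) : 0 ≤ (G 1).re := by
  have hlim : Tendsto (fun x : ℝ ↦ (G x).re) (𝓝[>] 1) (𝓝 (G 1).re) := by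
    have : Continuous fun x : ℝ ↦ (G x).re := by fun_prop
    simpa using (this.tendsto 1).mono_left (nhdsWithin_le_nhds (s := Set.Ioi 1))
  refine ge_of_tendsto hlim ?_
  filter_upwards [self_mem_nhdsWithin] with x hx
  have hx' : (0 : ℂ) ≤ (x : ℂ) - 1 := by
    have : (0 : ℝ) ≤ x - 1 := sub_nonneg.mpr (le_of_lt hx)
    exact_mod_cast this
  rw [hGa x (by simpa using hx)]
  exact (Complex.le_def.mp
    (mul_nonneg hx' (tsum_nonneg fun n ↦ LSeries.term_nonneg (ha n) x))).1

namespace DirichletCharacter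

lemma conj_apply_of_sq_eq_one {q : ℕ} {χ : DirichletCharacter ℂ q} (hχ : χ ^ 2 = 1) (a : ZMod q) :
    starRingEnd ℂ (χ a) = χ a := by
  rcases MulChar.isQuadratic_iff_sq_eq_one.mpr hχ a with h | h | h <;> simp [h]

lemma abscissaOfAbsConv_zetaMul_le {q : ℕ} (χ : DirichletCharacter ℂ q) :
    LSeries.abscissaOfAbsConv χ.zetaMul ≤ 1 :=
  LSeries.abscissaOfAbsConv_le_of_forall_lt_LSeriesSummable fun y hy ↦
    χ.LSeriesSummable_zetaMul (by simpa using hy)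

variable {q : ℕ} [NeZero q] {χ : DirichletCharacter ℂ q}

lemma LFunction_ofReal_im (hχ : χ ^ 2 = 1) (hχ' : χ ≠ 1) {x : ℝ} (hx : 0 < x) :
    (χ.LFunction x).im = 0 := by
  rw [← conj_eq_iff_im, LFunction_eq_mul_integral hχ' (by simpa using hx), map_mul, conj_ofReal,
    ← integral_conj]
  congr 1
  refine setIntegral_congr_fun measurableSet_Ioi fun t ht ↦ ?_
  have ht0 : (0 : ℝ) ≤ t := zero_le_one.trans (le_of_lt ht)
  have hcpow : (t : ℂ) ^ (-((x : ℂ) + 1)) = ((t ^ (-(x + 1)) : ℝ) : ℂ) := by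
    rw [ofReal_cpow ht0]
    push_cast
    rfl
  simp only [map_mul, map_sum, conj_apply_of_sq_eq_one hχ, hcpow, conj_ofReal]

lemma LFunctionTrivChar₁_mul_LFunction_eq {s : ℂ} (hs : 1 < s.re) :
    ζ₁ s * χ.LFunction s = (s - 1) * LSeries χ.zetaMul s := by
  have hs1 : s ≠ 1 := by rintro rfl; simp at hs
  rw [LSeries_zetaMul χ hs, LFunctionTrivChar₁_one_apply_of_ne_one hs1, mul_assoc]

lemma differentiable_LFunctionTrivChar₁_mul_LFunction (hχ : χ ≠ 1) :
    Differentiable ℂ fun s ↦ ζ₁ s * χ.LFunction s :=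
  (differentiable_LFunctionTrivChar₁ 1).mul (differentiable_LFunction hχ)

lemma LFunction_one_re_pos (hχ : χ ^ 2 = 1) (hχ' : χ ≠ 1) : 0 < (χ.LFunction 1).re := by
  have him := LFunction_ofReal_im hχ hχ' one_pos
  rw [ofReal_one] at him
  have h := residue_nonneg (fun n ↦ zetaMul_nonneg hχ n)
    (differentiable_LFunctionTrivChar₁_mul_LFunction hχ').continuous
    (fun s hs ↦ LFunctionTrivChar₁_mul_LFunction_eq hs)
  simp only [LFunctionTrivChar₁_one_apply_one, one_mul] at h
  refine h.lt_of_ne' fun h0 ↦ LFunction_apply_one_ne_zero hχ' (Complex.ext h0 him)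

lemma norm_LFunction_le_of_norm_sub_two (hχ : χ ≠ 1) {s : ℂ} (hs : ‖s - 2‖ = 3 / 2) :
    ‖χ.LFunction s‖ ≤ 7 * q := by
  have hre : 1 / 2 ≤ s.re := by
    have := (abs_le.mp ((abs_re_le_norm (s - 2)).trans hs.le)).1
    simp at this
    linarith
  have hnorm : ‖s‖ ≤ 7 / 2 := by
    have := norm_add_le (s - 2) 2
    rw [hs, sub_add_cancel] at this
    norm_num at this
    exact this
  refine (norm_LFunction_le hχ zero_le_one le_rfl (by linarith)).trans ?_
  rw [Real.rpow_one, div_le_iff₀ (by linarith)]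
  have : (0 : ℝ) ≤ q := q.cast_nonneg
  nlinarith

lemma norm_LFunction_one_le (hχ : χ ≠ 1) {θ : ℝ} (hθ : 0 < θ) (hθ' : θ ≤ 1) :
    ‖χ.LFunction 1‖ ≤ (q : ℝ) ^ θ / θ := by
  simpa using norm_LFunction_le hχ hθ.le hθ' (s := 1) (by simpa using hθ)

lemma exists_norm_LFunctionTrivChar₁_le :
    ∃ B : ℝ, 1 ≤ B ∧ ∀ s : ℂ, ‖s - 2‖ = 3 / 2 → ‖ζ₁ s‖ ≤ B := by
  obtain ⟨B, hB⟩ := (isCompact_sphere (2 : ℂ) (3 / 2)).exists_bound_of_continuousOn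
    (differentiable_LFunctionTrivChar₁ 1).continuous.continuousOn
  exact ⟨max 1 B, le_max_left _ _,
    fun s hs ↦ (hB s (by rwa [mem_sphere_iff_norm])).trans (le_max_right _ _)⟩

lemma LFunction_one_lower_bound_of_nonneg (hχ : χ ^ 2 = 1) (hχ' : χ ≠ 1) {B : ℝ} (hB : 1 ≤ B)
    (hBζ : ∀ s : ℂ, ‖s - 2‖ = 3 / 2 → ‖ζ₁ s‖ ≤ B) {δ : ℝ} (hδ : 0 < δ) (hδ' : δ ≤ 1 / 8)
    (h : 0 ≤ (ζ₁ (1 - δ : ℝ) * χ.LFunction (1 - δ : ℝ)).re) :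
    δ / 2 * (43 * (7 * B * q)) ^ (-(4 * δ)) ≤ (χ.LFunction 1).re := by
  have hq : (1 : ℝ) ≤ q := by exact_mod_cast NeZero.one_le
  have key := residue_lower_bound (M := 7 * B * q) (fun n ↦ zetaMul_nonneg hχ n)
    (isMultiplicative_zetaMul χ).map_one.ge
    χ.abscissaOfAbsConv_zetaMul_le (differentiable_LFunctionTrivChar₁_mul_LFunction hχ')
    (fun s hs ↦ LFunctionTrivChar₁_mul_LFunction_eq hs) (by nlinarith)
    (fun s hs ↦ ?_) hδ hδ' h
  · simpa only [LFunctionTrivChar₁_one_apply_one, one_mul] using key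
  · rw [norm_mul]
    calc _ ≤ B * (7 * q) := by
          gcongr
          exacts [hBζ s hs, norm_LFunction_le_of_norm_sub_two hχ' hs]
      _ = _ := by ring

lemma LFunction_one_mul_lower_bound {q₁ q₂ : ℕ} [NeZero q₁] [NeZero q₂]
    {χ₁ : DirichletCharacter ℂ q₁} {χ₂ : DirichletCharacter ℂ q₂}
    {ψ : DirichletCharacter ℂ (q₁ * q₂)} (hχ₁ : χ₁ ^ 2 = 1) (hχ₂ : χ₂ ^ 2 = 1)
    (hχ₁' : χ₁ ≠ 1) (hχ₂' : χ₂ ≠ 1) (hψ' : ψ ≠ 1) (hψ : ∀ n : ℕ, ψ n = χ₁ n * χ₂ n)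
    {B : ℝ} (hB : 1 ≤ B) (hBζ : ∀ s : ℂ, ‖s - 2‖ = 3 / 2 → ‖ζ₁ s‖ ≤ B)
    {δ : ℝ} (hδ : 0 < δ) (hδ' : δ ≤ 1 / 8) (h : ζ₁ (1 - δ : ℝ) * χ₁.LFunction (1 - δ : ℝ) = 0) :
    δ / 2 * (43 * (343 * B * q₁ ^ 2 * q₂ ^ 2)) ^ (-(4 * δ)) ≤
      (χ₁.LFunction 1).re * (χ₂.LFunction 1).re * ‖ψ.LFunction 1‖ := by
  have hq₁ : (1 : ℝ) ≤ q₁ := by exact_mod_cast NeZero.one_le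
  have hq₂ : (1 : ℝ) ≤ q₂ := by exact_mod_cast NeZero.one_le
  have habs : LSeries.abscissaOfAbsConv (biquadraticMul χ₁ χ₂ ψ) ≤ 1 :=
    LSeries.abscissaOfAbsConv_le_of_forall_lt_LSeriesSummable fun y hy ↦
      LSeriesSummable_biquadraticMul χ₁ χ₂ ψ (by simpa using hy)
  have hd : Differentiable ℂ fun s ↦
      ζ₁ s * χ₁.LFunction s * (χ₂.LFunction s * ψ.LFunction s) :=
    (differentiable_LFunctionTrivChar₁_mul_LFunction hχ₁').mul
      ((differentiable_LFunction hχ₂').mul (differentiable_LFunction hψ'))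
  have key := residue_lower_bound (M := 343 * B * q₁ ^ 2 * q₂ ^ 2)
    (fun n ↦ biquadraticMul_nonneg hχ₁ hχ₂ hψ n)
    (isMultiplicative_biquadraticMul χ₁ χ₂ ψ).map_one.ge habs hd
    (fun s hs ↦ ?_) ?_ (fun s hs ↦ ?_) hδ hδ' (by simp only [h, zero_mul, zero_re, le_refl])
  · simp only [LFunctionTrivChar₁_one_apply_one, one_mul] at key
    have him₁ := LFunction_ofReal_im hχ₁ hχ₁' one_pos
    have him₂ := LFunction_ofReal_im hχ₂ hχ₂' one_pos
    rw [ofReal_one] at him₁ him₂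
    refine key.trans ?_
    have h₁ := LFunction_one_re_pos hχ₁ hχ₁'
    have h₂ := LFunction_one_re_pos hχ₂ hχ₂'
    rw [← mul_assoc, mul_re, mul_re, mul_im, him₁, him₂]
    simp only [mul_zero, zero_mul, sub_zero, add_zero]
    gcongr
    exact re_le_norm _
  · have hs1 : s ≠ 1 := by rintro rfl; simp at hs
    rw [LSeries_biquadraticMul _ _ _ hs, LFunctionTrivChar₁_one_apply_of_ne_one hs1]
    ring
  · have h1 : (1 : ℝ) ≤ q₁ ^ 2 := one_le_pow₀ hq₁
    have h2 : (1 : ℝ) ≤ q₂ ^ 2 := one_le_pow₀ hq₂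
    calc (1 : ℝ) = 1 * 1 * 1 * 1 := by norm_num
      _ ≤ _ := by gcongr; norm_num
  · rw [norm_mul, norm_mul, norm_mul]
    calc _ ≤ B * (7 * q₁) * (7 * q₂ * (7 * (q₁ * q₂ : ℕ))) := by
          gcongr
          exacts [hBζ s hs, norm_LFunction_le_of_norm_sub_two hχ₁' hs,
            norm_LFunction_le_of_norm_sub_two hχ₂' hs, norm_LFunction_le_of_norm_sub_two hψ' hs]
      _ = _ := by push_cast; ring

/-- A uniform positive lower bound for the finitely many values at a fixed level. -/
lemma exists_lt_LFunction_one (q : ℕ) [NeZero q] :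
    ∃ c : ℝ, 0 < c ∧ ∀ χ : DirichletCharacter ℂ q, χ ^ 2 = 1 → χ ≠ 1 → c < (χ.LFunction 1).re := by
  have h : ∀ᶠ c : ℝ in 𝓝[>] 0,
      ∀ χ : DirichletCharacter ℂ q, χ ^ 2 = 1 → χ ≠ 1 → c < (χ.LFunction 1).re := by
    refine eventually_all.mpr fun χ ↦ ?_
    by_cases hχ : χ ^ 2 = 1 ∧ χ ≠ 1
    · filter_upwards [Ioo_mem_nhdsGT (LFunction_one_re_pos hχ.1 hχ.2)] with c hc _ _ using hc.2
    · exact Eventually.of_forall fun c h₁ h₂ ↦ absurd ⟨h₁, h₂⟩ hχ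
  obtain ⟨c, hc, hc0⟩ := (h.and self_mem_nhdsWithin).exists
  exact ⟨c, hc0, hc⟩

lemma exists_eq_zero_of_neg (hχ : χ ^ 2 = 1) (hχ' : χ ≠ 1) {δ : ℝ} (hδ : 0 < δ) (hδ' : δ ≤ 1 / 8)
    (h : (ζ₁ (1 - δ : ℝ) * χ.LFunction (1 - δ : ℝ)).re < 0) :
    ∃ η : ℝ, 0 < η ∧ η ≤ δ ∧ ζ₁ (1 - η : ℝ) * χ.LFunction (1 - η : ℝ) = 0 := by
  set g : ℝ → ℝ := fun η ↦ (ζ₁ (1 - η : ℝ) * χ.LFunction (1 - η : ℝ)).re with hg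
  have hcont : Continuous g := by
    have := (differentiable_LFunctionTrivChar₁_mul_LFunction hχ').continuous
    exact continuous_re.comp
      (this.comp (continuous_ofReal.comp (continuous_const.sub continuous_id)))
  have hg0 : 0 < g 0 := by
    simp only [hg, sub_zero, ofReal_one, LFunctionTrivChar₁_one_apply_one, one_mul]
    exact LFunction_one_re_pos hχ hχ'
  obtain ⟨η, hη, hη0⟩ := intermediate_value_Icc' hδ.le hcont.continuousOn ⟨h.le, hg0.le⟩
  refine ⟨η, hη.1.lt_of_ne ?_, hη.2, Complex.ext hη0 ?_⟩
  · rintro rfl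
    exact hg0.ne' hη0
  · rw [mul_im, LFunctionTrivChar₁_one_ofReal_im,
      LFunction_ofReal_im hχ hχ' (x := 1 - η) (by linarith [hη.2])]
    simp

end DirichletCharacter

open DirichletCharacter

lemma exists_lower_bound_LFunction_one (ε : ℝ) (hε : 0 < ε) : ∃ C : ℝ, 0 < C ∧
    ∀ (q : ℕ) [NeZero q] (χ : DirichletCharacter ℂ q), χ.IsPrimitive → χ ^ 2 = 1 → χ ≠ 1 →
      C * (q : ℝ) ^ (-ε) ≤ (χ.LFunction 1).re := by
  obtain ⟨B, hB, hBζ⟩ := exists_norm_LFunctionTrivChar₁_le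
  obtain ⟨δ, hδ, hδ', hδε⟩ : ∃ δ : ℝ, 0 < δ ∧ δ ≤ 1 / 8 ∧ 16 * δ ≤ ε :=
    ⟨min (1 / 8) (ε / 16), by positivity, min_le_left _ _, by
      linarith [min_le_right (1 / 8) (ε / 16)]⟩
  by_cases hall : ∀ (q : ℕ) [NeZero q] (χ : DirichletCharacter ℂ q), χ.IsPrimitive → χ ^ 2 = 1 →
      χ ≠ 1 → 0 ≤ (ζ₁ (1 - δ : ℝ) * χ.LFunction (1 - δ : ℝ)).re
  · refine ⟨δ / 2 * (43 * 7 * B) ^ (-(4 * δ)), by positivity, fun q _ χ hp hχ hχ' ↦ ?_⟩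
    have hq : (1 : ℝ) ≤ q := by exact_mod_cast NeZero.one_le
    refine le_trans ?_
      (LFunction_one_lower_bound_of_nonneg hχ hχ' hB hBζ hδ hδ' (hall q χ hp hχ hχ'))
    rw [show 43 * (7 * B * (q : ℝ)) = 43 * 7 * B * q by ring,
      Real.mul_rpow (x := 43 * 7 * B) (y := (q : ℝ)) (by positivity) (by positivity), ← mul_assoc]
    exact mul_le_mul_of_nonneg_left (Real.rpow_le_rpow_of_exponent_le hq (by linarith))
      (by positivity)
  · push Not at hall
    obtain ⟨q₁, _, χ₁, hp₁, hχ₁, hχ₁', hneg⟩ := hall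
    obtain ⟨η, hη, hηδ, hzero⟩ := exists_eq_zero_of_neg hχ₁ hχ₁' hδ hδ' hneg
    obtain ⟨c, hc, hc'⟩ := exists_lt_LFunction_one q₁
    obtain ⟨θ, hθ, hθ', hθε⟩ : ∃ θ : ℝ, 0 < θ ∧ θ ≤ 1 ∧ 2 * θ ≤ ε :=
      ⟨min 1 (ε / 2), by positivity, min_le_left _ _, by linarith [min_le_right 1 (ε / 2)]⟩
    have hq₁ : (1 : ℝ) ≤ q₁ := by exact_mod_cast NeZero.one_le
    have hL₁ := LFunction_one_re_pos hχ₁ hχ₁'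
    set K := (χ₁.LFunction 1).re * ((q₁ : ℝ) ^ θ / θ) with hK
    set D := η / 2 * (43 * 343 * B * q₁ ^ 2) ^ (-(4 * η)) with hD
    have hK0 : 0 < K := by positivity
    have hD0 : 0 < D := by positivity
    refine ⟨min c (D / K), by positivity, fun q₂ _ χ₂ hp₂ hχ₂ hχ₂' ↦ ?_⟩
    have hq₂ : (1 : ℝ) ≤ q₂ := by exact_mod_cast NeZero.one_le
    rcases eq_or_ne q₁ q₂ with rfl | hne
    · calc _ ≤ c * 1 := by
            gcongr
            · exact min_le_left _ _
            · exact Real.rpow_le_one_of_one_le_of_nonpos hq₂ (by linarith)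
        _ ≤ _ := by
            rw [mul_one]
            exact (hc' χ₂ hχ₂ hχ₂').le
    · obtain ⟨ψ, hψ', hψ⟩ := exists_mul_character hχ₁ hp₁ hp₂ hne
      have hL₂ := LFunction_one_re_pos hχ₂ hχ₂'
      have key := LFunction_one_mul_lower_bound hχ₁ hχ₂ hχ₁' hχ₂' hψ' hψ hB hBζ hη
        (hηδ.trans hδ') hzero
      have hL₃ := norm_LFunction_one_le hψ' hθ hθ'
      have hupper : (χ₁.LFunction 1).re * (χ₂.LFunction 1).re * ‖ψ.LFunction 1‖ ≤
          K * (q₂ : ℝ) ^ θ * (χ₂.LFunction 1).re := by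
        calc _ ≤ (χ₁.LFunction 1).re * (χ₂.LFunction 1).re * (((q₁ * q₂ : ℕ) : ℝ) ^ θ / θ) := by
              gcongr
          _ = _ := by
              rw [hK, Nat.cast_mul, Real.mul_rpow (by positivity) (by positivity)]
              ring
      have hlower : D * (q₂ : ℝ) ^ (-(8 * η)) =
          η / 2 * (43 * (343 * B * q₁ ^ 2 * q₂ ^ 2)) ^ (-(4 * η)) := by
        rw [hD, show 43 * (343 * B * (q₁ : ℝ) ^ 2 * (q₂ : ℝ) ^ 2) =
          (43 * 343 * B * q₁ ^ 2) * q₂ ^ 2 by ring,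
          Real.mul_rpow (x := 43 * 343 * B * (q₁ : ℝ) ^ 2) (by positivity) (by positivity),
          ← Real.rpow_natCast (q₂ : ℝ) 2, ← Real.rpow_mul (by positivity)]
        push_cast
        ring_nf
      have hle := (hlower.le.trans key).trans hupper
      have hq₂θ : (0 : ℝ) < (q₂ : ℝ) ^ θ := by positivity
      calc _ ≤ D / K * (q₂ : ℝ) ^ (-(8 * η) - θ) := by
            gcongr
            · exact min_le_right _ _
            · linarith
        _ = D * (q₂ : ℝ) ^ (-(8 * η)) / (K * (q₂ : ℝ) ^ θ) := by
            rw [Real.rpow_sub (by positivity)]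
            field_simp
        _ ≤ _ := by
            rw [div_le_iff₀ (by positivity)]
            linarith

end Siegel

end

/-- **Siegel's theorem**: for every `ε > 0` there is `C = C(ε) > 0` such that for every
positive integer `q` and every primitive quadratic Dirichlet character `χ` mod `q`,
the value `L(1, χ)` is a positive real number with `L(1, χ) > C * q ^ (-ε)`. -/
theorem siegel_theorem :
    ∀ ε : ℝ, 0 < ε → ∃ C : ℝ, 0 < C ∧
      ∀ (q : ℕ) [NeZero q] (χ : DirichletCharacter ℂ q),
        χ.IsPrimitive → χ ^ 2 = 1 → χ ≠ 1 →
        ∃ L : ℝ, χ.LFunction 1 = (L : ℂ) ∧ 0 < L ∧ C * (q : ℝ) ^ (-ε) < L := by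
  intro ε hε
  obtain ⟨C, hC, h⟩ := exists_lower_bound_LFunction_one ε hε
  refine ⟨C / 2, half_pos hC, fun q _ χ hp hχ hχ' ↦ ⟨(χ.LFunction 1).re, Complex.ext rfl ?_,
    DirichletCharacter.LFunction_one_re_pos hχ hχ', ?_⟩⟩
  · simpa using DirichletCharacter.LFunction_ofReal_im hχ hχ' one_pos
  · have hq : (0 : ℝ) < (q : ℝ) ^ (-ε) :=
      Real.rpow_pos_of_pos (Nat.cast_pos.mpr (NeZero.pos q)) _
    linarith [mul_pos hC hq, h q χ hp hχ hχ']
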